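/- (i) If s > 3/2 and β ≤ δ + 3/2, then there is a constant C such that every u ∈ H_{s,δ}(ℝ³) satisfies ‖u‖_{L^∞_β} ≤ C ‖u‖_{H_{s,δ}}. (ii) If m is a nonnegative integer with m + 3/2 < s and β ≤ δ + 3/2, then there is a constant C such that every u ∈ H_{s,δ}(ℝ³) has continuous partial derivatives up to order m and ‖u‖_{C^m_β} ≤ C ‖u‖_{H_{s,δ}}. -/

import Mathlib

open MeasureTheory Real Set
open scoped FourierTransform ENNReal NNReal

noncomputable section

abbrev E3 : Type := EuclideanSpace ℝ (Fin 3)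

/-- A dyadic partition of unity on ℝ³ as in the paper: `ψ j ∈ C_0^∞`, nonnegative,
`supp ψ₀ ⊆ {|x| ≤ 2}`, `ψ₀ = 1` on `{|x| ≤ 1}`, for `j ≥ 1`
`supp ψ_j ⊆ {2^(j-2) ≤ |x| ≤ 2^(j+1)}`, `ψ_j = 1` on `{2^(j-1) ≤ |x| ≤ 2^j}`, and
`|∂^α ψ_j| ≤ C_α 2^(-|α| j)` with `C_α` independent of `j`. -/
structure DyadicPartition where
  ψ : ℕ → E3 → ℝ
  smooth : ∀ j, ContDiff ℝ (⊤ : ℕ∞) (ψ j)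
  nonneg : ∀ j x, 0 ≤ ψ j x
  compSupp : ∀ j, HasCompactSupport (ψ j)
  supp_zero : ∀ x : E3, ψ 0 x ≠ 0 → ‖x‖ ≤ 2
  one_zero : ∀ x : E3, ‖x‖ ≤ 1 → ψ 0 x = 1
  supp_succ : ∀ j : ℕ, 1 ≤ j → ∀ x : E3, ψ j x ≠ 0 →
    (2:ℝ) ^ ((j:ℤ) - 2) ≤ ‖x‖ ∧ ‖x‖ ≤ (2:ℝ) ^ ((j:ℤ) + 1)
  one_succ : ∀ j : ℕ, 1 ≤ j → ∀ x : E3,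
    (2:ℝ) ^ ((j:ℤ) - 1) ≤ ‖x‖ → ‖x‖ ≤ (2:ℝ) ^ (j:ℤ) → ψ j x = 1
  deriv_bound : ∀ n : ℕ, ∃ C : ℝ, ∀ (j : ℕ) (x : E3),
    ‖iteratedFDeriv ℝ n (ψ j) x‖ ≤ C * (2:ℝ) ^ (-(n:ℤ) * (j:ℤ))

/-- The squared `H^s` norm `∫ (1+|ξ|²)^s |𝓕f(ξ)|² dξ` of a complex-valued function. -/
def HsNormSq (s : ℝ) (f : E3 → ℂ) : ℝ≥0∞ :=
  ∫⁻ ξ : E3, ENNReal.ofReal ((1 + ‖ξ‖ ^ 2) ^ s) * (‖𝓕 f ξ‖₊ : ℝ≥0∞) ^ 2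

/-- The squared weighted Sobolev norm
`‖u‖²_{H_{s,δ}} = Σ_j 2^{(3/2+δ)2j} ‖(ψ_j u)_{2^j}‖²_{H^s}`,
where `(ψ_j u)_{2^j}(x) = ψ_j(2^j x) u(2^j x)`. -/
def HwNormSq (P : DyadicPartition) (s δ : ℝ) (u : E3 → ℝ) : ℝ≥0∞ :=
  ∑' j : ℕ, ENNReal.ofReal ((2:ℝ) ^ ((3 + 2 * δ) * (j:ℝ))) *
    HsNormSq s (fun x : E3 =>
      ((P.ψ j (((2:ℝ) ^ (j:ℕ)) • x) * u (((2:ℝ) ^ (j:ℕ)) • x) : ℝ) : ℂ))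

/-- Membership in the weighted Sobolev space `H_{s,δ}` (for functions). -/
def MemH (P : DyadicPartition) (s δ : ℝ) (u : E3 → ℝ) : Prop :=
  LocallyIntegrable u volume ∧ HwNormSq P s δ u < ⊤

/-- The weighted Sobolev norm `‖u‖_{H_{s,δ}}`. -/
def Hnorm (P : DyadicPartition) (s δ : ℝ) (u : E3 → ℝ) : ℝ :=
  Real.sqrt (HwNormSq P s δ u).toReal

/-- The squared weighted `L²_δ` norm `∫ (1+|x|)^{2δ} |u(x)|² dx`. -/
def L2wNormSq (δ : ℝ) (u : E3 → ℝ) : ℝ≥0∞ :=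
  ∫⁻ x : E3, ENNReal.ofReal ((1 + ‖x‖) ^ (2 * δ)) * (‖u x‖₊ : ℝ≥0∞) ^ 2

/-- The weighted `L²_δ` norm. -/
def L2wNorm (δ : ℝ) (u : E3 → ℝ) : ℝ :=
  Real.sqrt (L2wNormSq δ u).toReal

/-- Membership in `L²_δ`. -/
def MemL2w (δ : ℝ) (u : E3 → ℝ) : Prop :=
  AEStronglyMeasurable u volume ∧ L2wNormSq δ u < ⊤

/-- The partial derivative `∂_a f (x)`. -/
def pd (f : E3 → ℝ) (a : Fin 3) (x : E3) : ℝ :=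
  fderiv ℝ f x (EuclideanSpace.single a 1)

section FourierInversion

variable {V : Type*} [NormedAddCommGroup V] [InnerProductSpace ℝ V] [FiniteDimensional ℝ V]
  [MeasurableSpace V] [BorelSpace V]

/-- The inverse Fourier transform is self-adjoint on integrable functions. -/
lemma integral_mul_fourierInv_eq {f g : V → ℂ} (hf : Integrable f) (hg : Integrable g) :
    ∫ x, 𝓕⁻ f x * g x = ∫ ξ, f ξ * 𝓕⁻ g ξ := by
  have hL : Continuous fun p : V × V ↦ (-innerₗ V) p.1 p.2 := continuous_inner.neg
  have hflip : (-innerₗ V).flip = -innerₗ V := by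
    ext x y
    simp [real_inner_comm]
  have h := VectorFourier.integral_fourierIntegral_smul_eq_flip (L := -innerₗ V)
    Real.continuous_fourierChar hL hf hg
  rw [hflip] at h
  exact h

/-- The Fourier transform is self-adjoint on integrable functions. -/
lemma integral_mul_fourier_eq {f g : V → ℂ} (hf : Integrable f) (hg : Integrable g) :
    ∫ ξ, 𝓕 f ξ * g ξ = ∫ x, f x * 𝓕 g x := by
  have h := VectorFourier.integral_fourierIntegral_smul_eq_flip (L := innerₗ V)
    Real.continuous_fourierChar continuous_inner hf hg
  rw [flip_innerₗ] at h
  exact h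

lemma continuous_fourier_of_integrable {f : V → ℂ} (hf : Integrable f) : Continuous (𝓕 f) :=
  VectorFourier.fourierIntegral_continuous Real.continuous_fourierChar
    (L := innerₗ V) continuous_inner hf

/-- Fourier inversion almost everywhere, for an integrable function whose Fourier transform is
integrable. -/
lemma ae_eq_fourierInv_fourier {f : V → ℂ} (hf : Integrable f) (hf' : Integrable (𝓕 f)) :
    f =ᵐ[volume] 𝓕⁻ (𝓕 f) := by
  have hcont : Continuous (𝓕⁻ (𝓕 f)) := by
    have : 𝓕⁻ (𝓕 f) = fun x ↦ 𝓕 (𝓕 f) (-x) := funext fun x ↦ fourierInv_eq_fourier_neg _ x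
    rw [this]
    exact (continuous_fourier_of_integrable hf').comp continuous_neg
  refine ae_eq_of_integral_contDiff_smul_eq hf.locallyIntegrable hcont.locallyIntegrable ?_
  intro g hg hgs
  have hc : HasCompactSupport (fun x ↦ (g x : ℂ)) := hgs.comp_left Complex.ofReal_zero
  have hs : ContDiff ℝ (⊤ : ℕ∞) (fun x ↦ (g x : ℂ)) := Complex.ofRealCLM.contDiff.comp hg
  let φ : SchwartzMap V ℂ := hc.toSchwartzMap hs
  have hφ : ∀ x, φ x = (g x : ℂ) := fun x ↦ rfl
  have hinv : 𝓕 (𝓕⁻ (φ : V → ℂ)) = φ := by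
    rw [← SchwartzMap.fourierInv_coe, ← SchwartzMap.fourier_coe]
    simp
  have hInt : Integrable (𝓕⁻ (φ : V → ℂ)) := by
    rw [← SchwartzMap.fourierInv_coe]
    exact SchwartzMap.integrable _
  symm
  calc ∫ x, g x • 𝓕⁻ (𝓕 f) x = ∫ x, 𝓕⁻ (𝓕 f) x * φ x := by
        congr with x
        rw [hφ, Complex.real_smul, mul_comm]
    _ = ∫ ξ, 𝓕 f ξ * 𝓕⁻ (φ : V → ℂ) ξ := integral_mul_fourierInv_eq hf' φ.integrable
    _ = ∫ x, f x * φ x := by rw [integral_mul_fourier_eq hf hInt, hinv]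
    _ = ∫ x, g x • f x := by
        congr with x
        rw [hφ, Complex.real_smul, mul_comm]

/-- The iterated derivatives of a Fourier transform are bounded by the moments. -/
lemma norm_iteratedFDeriv_fourier_le_integral {F : V → ℂ} {m k : ℕ}
    (hF : ∀ n : ℕ, n ≤ m → Integrable (fun ξ ↦ ‖ξ‖ ^ n * ‖F ξ‖))
    (hFm : AEStronglyMeasurable F) (hk : k ≤ m) (x : V) :
    ‖iteratedFDeriv ℝ k (𝓕 F) x‖ ≤ (2 * π) ^ k * ∫ ξ, ‖ξ‖ ^ k * ‖F ξ‖ := by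
  have hF' : ∀ n : ℕ, (n : ℕ∞) ≤ (m : ℕ∞) → Integrable (fun ξ ↦ ‖ξ‖ ^ n * ‖F ξ‖) :=
    fun n hn ↦ hF n (by exact_mod_cast hn)
  rw [iteratedFDeriv_fourier hF' hFm (n := k) (by exact_mod_cast hk)]
  refine (VectorFourier.norm_fourierIntegral_le_integral_norm _ _ _ _ _).trans ?_
  rw [← integral_const_mul]
  refine integral_mono_of_nonneg (.of_forall fun _ ↦ norm_nonneg _) ((hF k hk).const_mul _)
    (.of_forall fun ξ ↦ ?_)
  refine (VectorFourier.norm_fourierPowSMulRight_le _ _ _ _).trans ?_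
  have hL : 2 * π * ‖innerSL ℝ (E := V)‖ ≤ 2 * π :=
    mul_le_of_le_one_right (by positivity) (norm_innerSL_le ℝ)
  calc (2 * π * ‖innerSL ℝ (E := V)‖) ^ k * ‖ξ‖ ^ k * ‖F ξ‖
      ≤ (2 * π) ^ k * ‖ξ‖ ^ k * ‖F ξ‖ := by gcongr
    _ = (2 * π) ^ k * (‖ξ‖ ^ k * ‖F ξ‖) := mul_assoc _ _ _

end FourierInversion

/-- Cauchy–Schwarz bound for the moments of a function by a weighted `L²` norm. -/
lemma exists_lintegral_pow_norm_mul_le {m : ℕ} {s : ℝ} (hs : (m : ℝ) + 3 / 2 < s) :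
    ∃ K : ℝ≥0∞, K < ⊤ ∧ ∀ F : E3 → ℂ, AEStronglyMeasurable F → ∀ k ≤ m,
      ∫⁻ ξ, ‖‖ξ‖ ^ k * ‖F ξ‖‖ₑ ≤ K *
        (∫⁻ ξ, ENNReal.ofReal ((1 + ‖ξ‖ ^ 2) ^ s) * (‖F ξ‖₊ : ℝ≥0∞) ^ 2) ^ (1 / 2 : ℝ) := by
  have hInt : Integrable (fun ξ : E3 ↦ (1 + ‖ξ‖ ^ 2) ^ (-(2 * (s - m)) / 2)) :=
    integrable_rpow_neg_one_add_norm_sq (by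
      rw [finrank_euclideanSpace_fin]; push_cast; linarith)
  refine ⟨(∫⁻ ξ : E3, ENNReal.ofReal ((1 + ‖ξ‖ ^ 2) ^ (((m : ℝ) - s) / 2)) ^ (2 : ℝ))
    ^ (1 / 2 : ℝ), ?_, ?_⟩
  · refine ENNReal.rpow_lt_top_of_nonneg (by norm_num) (ne_of_lt ?_)
    refine lt_of_eq_of_lt (lintegral_congr fun ξ ↦ ?_) hInt.lintegral_lt_top
    rw [ENNReal.ofReal_rpow_of_nonneg (by positivity) (by norm_num), ← rpow_mul (by positivity)]
    congr 2
    ring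
  · intro F hF k hk
    have hmeas : ∀ a : ℝ, Measurable fun ξ : E3 ↦ ENNReal.ofReal ((1 + ‖ξ‖ ^ 2) ^ a) := by
      intro a
      fun_prop
    have hFe : AEMeasurable (fun ξ ↦ ENNReal.ofReal ((1 + ‖ξ‖ ^ 2) ^ (s / 2)) * ‖F ξ‖ₑ) :=
      (hmeas _).aemeasurable.mul hF.enorm
    have hCS := ENNReal.lintegral_mul_le_Lp_mul_Lq volume Real.HolderConjugate.two_two
      (hmeas (((m : ℝ) - s) / 2)).aemeasurable hFe
    refine (lintegral_mono fun ξ ↦ ?_).trans (hCS.trans_eq ?_)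
    · simp only [Pi.mul_apply]
      rw [← mul_assoc, ← ENNReal.ofReal_mul (by positivity), ← rpow_add (by positivity),
        enorm_mul, enorm_norm]
      gcongr
      rw [Real.enorm_eq_ofReal (by positivity)]
      refine ENNReal.ofReal_le_ofReal ?_
      have h1 : (1 : ℝ) ≤ 1 + ‖ξ‖ ^ 2 := by nlinarith [sq_nonneg ‖ξ‖]
      calc ‖ξ‖ ^ k ≤ √(1 + ‖ξ‖ ^ 2) ^ k := by
            gcongr
            exact Real.le_sqrt_of_sq_le (by linarith)
        _ ≤ √(1 + ‖ξ‖ ^ 2) ^ m := pow_le_pow_right₀ (Real.one_le_sqrt.2 h1) hk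
        _ = (1 + ‖ξ‖ ^ 2) ^ ((m - s) / 2 + s / 2) := by
            rw [Real.sqrt_eq_rpow, ← rpow_mul_natCast (by positivity)]
            congr 1
            ring
    · congr 2
      refine lintegral_congr fun ξ ↦ ?_
      rw [ENNReal.mul_rpow_of_nonneg _ _ (by norm_num),
        ENNReal.ofReal_rpow_of_nonneg (by positivity) (by norm_num), ← rpow_mul (by positivity)]
      rw [div_mul_cancel₀ _ (by norm_num : (2 : ℝ) ≠ 0)]
      norm_cast

/-- Sobolev embedding `H^s ⊆ C^m` for integrable functions on `ℝ³`, `m + 3/2 < s`. -/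
lemma exists_contDiff_representative {m : ℕ} {s : ℝ} (hs : (m : ℝ) + 3 / 2 < s) :
    ∃ C : ℝ, 0 < C ∧ ∀ f : E3 → ℂ, Integrable f → HsNormSq s f < ⊤ →
      ∃ g : E3 → ℂ, ContDiff ℝ m g ∧ f =ᵐ[volume] g ∧
        ∀ k ≤ m, ∀ x, ‖iteratedFDeriv ℝ k g x‖ ≤ C * √(HsNormSq s f).toReal := by
  obtain ⟨K, hK, hbound⟩ := exists_lintegral_pow_norm_mul_le hs
  refine ⟨(2 * π) ^ m * (K.toReal + 1), by positivity, fun f hf hfs ↦ ?_⟩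
  have hFc : Continuous (𝓕 f) := continuous_fourier_of_integrable hf
  have hle := hbound (𝓕 f) hFc.aestronglyMeasurable
  have htop : K * HsNormSq s f ^ (1 / 2 : ℝ) < ⊤ :=
    ENNReal.mul_lt_top hK (ENNReal.rpow_lt_top_of_nonneg (by norm_num) hfs.ne)
  have hInt : ∀ n : ℕ, n ≤ m → Integrable (fun ξ ↦ ‖ξ‖ ^ n * ‖𝓕 f ξ‖) := fun n hn ↦
    ⟨(by fun_prop : Continuous fun ξ ↦ ‖ξ‖ ^ n * ‖𝓕 f ξ‖).aestronglyMeasurable,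
      (hle n hn).trans_lt htop⟩
  have hIntF : Integrable (𝓕 f) := by
    refine (integrable_norm_iff hFc.aestronglyMeasurable).1 ?_
    simpa using hInt 0 m.zero_le
  have hinv : 𝓕⁻ (𝓕 f) = fun x ↦ 𝓕 (𝓕 f) ((-1 : ℝ) • x) := by
    funext x
    rw [fourierInv_eq_fourier_neg, neg_one_smul]
  have hcd : ContDiff ℝ m (𝓕 (𝓕 f)) :=
    contDiff_fourier (N := m) fun n hn ↦ hInt n (by exact_mod_cast hn)
  refine ⟨𝓕⁻ (𝓕 f), ?_, ae_eq_fourierInv_fourier hf hIntF, fun k hk x ↦ ?_⟩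
  · rw [hinv]
    exact hcd.comp (contDiff_const_smul _)
  · rw [hinv, iteratedFDeriv_comp_const_smul _ (hcd.of_le (by exact_mod_cast hk))]
    simp only [norm_smul, norm_pow, norm_neg, norm_one, one_pow, one_mul]
    refine (norm_iteratedFDeriv_fourier_le_integral hInt hFc.aestronglyMeasurable hk _).trans ?_
    have hI : ∫ ξ, ‖ξ‖ ^ k * ‖𝓕 f ξ‖ ≤ K.toReal * √(HsNormSq s f).toReal := by
      have h := ENNReal.toReal_mono htop.ne (hle k hk)
      rw [ENNReal.toReal_mul, ← ENNReal.toReal_rpow, ← Real.sqrt_eq_rpow,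
        ← integral_norm_eq_lintegral_enorm (hInt k hk).1] at h
      simpa [abs_of_nonneg] using h
    have hπ : (1 : ℝ) ≤ 2 * π := by linarith [Real.pi_gt_three]
    rw [mul_assoc]
    gcongr
    refine hI.trans ?_
    gcongr
    linarith

/-- Each dyadic piece `ψ_j u` of `u ∈ H_{s,δ}` has a `C^m` representative with weighted bounds. -/
lemma exists_contDiff_dyadic_pieces (P : DyadicPartition) {m : ℕ} {s : ℝ} (δ : ℝ)
    (hs : (m : ℝ) + 3 / 2 < s) :
    ∃ C : ℝ, 0 < C ∧ ∀ u : E3 → ℝ, MemH P s δ u → ∃ h : ℕ → E3 → ℝ, ∀ j,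
      ContDiff ℝ m (h j) ∧ (h j =ᵐ[volume] fun x ↦ P.ψ j x * u x) ∧
      ∀ k ≤ m, ∀ x, ‖iteratedFDeriv ℝ k (h j) x‖ ≤
        C * (2 : ℝ) ^ (-((δ + 3 / 2 + k) * j)) * Hnorm P s δ u := by
  obtain ⟨C, hC, hemb⟩ := exists_contDiff_representative hs
  refine ⟨C, hC, fun u ⟨hu, hfin⟩ ↦ ?_⟩
  suffices H : ∀ j, ∃ h : E3 → ℝ, ContDiff ℝ m h ∧ (h =ᵐ[volume] fun x ↦ P.ψ j x * u x) ∧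
      ∀ k ≤ m, ∀ x, ‖iteratedFDeriv ℝ k h x‖ ≤
        C * (2 : ℝ) ^ (-((δ + 3 / 2 + k) * j)) * Hnorm P s δ u by
    choose h hh using H
    exact ⟨h, hh⟩
  intro j
  set r : ℝ := 2 ^ j with hr
  have hr0 : r ≠ 0 := by positivity
  set f : E3 → ℂ := fun x ↦ ((P.ψ j (r • x) * u (r • x) : ℝ) : ℂ) with hf
  have hfint : Integrable f :=
    ((hu.integrable_smul_left_of_hasCompactSupport (P.smooth j).continuous
      (P.compSupp j)).comp_smul hr0).ofReal
  set a : ℝ := 2 ^ ((3 + 2 * δ) * (j : ℝ)) with ha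
  have ha0 : 0 < a := by positivity
  have hterm : ENNReal.ofReal a * HsNormSq s f ≤ HwNormSq P s δ u :=
    ENNReal.le_tsum (f := fun j : ℕ ↦ ENNReal.ofReal ((2:ℝ) ^ ((3 + 2 * δ) * (j:ℝ))) *
      HsNormSq s (fun x : E3 ↦
        ((P.ψ j (((2:ℝ) ^ (j:ℕ)) • x) * u (((2:ℝ) ^ (j:ℕ)) • x) : ℝ) : ℂ))) j
  have hffin : HsNormSq s f < ⊤ :=
    ENNReal.lt_top_of_mul_ne_top_right (hterm.trans_lt hfin).ne (by simpa using ha0)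
  have hnorm : √(HsNormSq s f).toReal ≤ 2 ^ (-((δ + 3 / 2) * j)) * Hnorm P s δ u := by
    have h1 := ENNReal.toReal_mono hfin.ne hterm
    rw [ENNReal.toReal_mul, ENNReal.toReal_ofReal ha0.le] at h1
    have h2 : √a = 2 ^ ((δ + 3 / 2) * j) := by
      rw [Real.sqrt_eq_rpow, ha, ← rpow_mul (by norm_num)]
      congr 1
      ring
    have h3 := Real.sqrt_le_sqrt h1
    rw [Real.sqrt_mul ha0.le, h2] at h3
    rw [rpow_neg (by norm_num), ← div_eq_inv_mul, le_div_iff₀ (by positivity), mul_comm]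
    exact h3
  obtain ⟨g, hg, hfg, hgb⟩ := hemb f hfint hffin
  have hg' : ContDiff ℝ m fun x ↦ g (r⁻¹ • x) := hg.comp (contDiff_const_smul _)
  refine ⟨fun x ↦ Complex.reCLM (g (r⁻¹ • x)), Complex.reCLM.contDiff.comp hg', ?_, ?_⟩
  · filter_upwards [(Measure.quasiMeasurePreserving_smul volume (inv_ne_zero hr0)).ae hfg]
      with x hx
    simp [← hx, hf, smul_smul, hr0]
  · intro k hk x
    have hk' : (k : WithTop ℕ∞) ≤ (m : WithTop ℕ∞) := by exact_mod_cast hk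
    refine (Complex.reCLM.norm_iteratedFDeriv_comp_left hg'.contDiffAt hk').trans ?_
    rw [Complex.reCLM_norm, one_mul, iteratedFDeriv_comp_const_smul _ (hg.of_le hk'), norm_smul]
    have hrk : ‖r⁻¹ ^ k‖ = 2 ^ (-((k : ℝ) * j)) := by
      rw [Real.norm_of_nonneg (by positivity), hr, ← Real.rpow_natCast, ← Real.rpow_natCast,
        ← rpow_neg (by norm_num), ← rpow_mul (by norm_num)]
      congr 1
      ring
    calc ‖r⁻¹ ^ k‖ * ‖iteratedFDeriv ℝ k g (r⁻¹ • x)‖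
        ≤ 2 ^ (-((k : ℝ) * j)) * (C * (2 ^ (-((δ + 3 / 2) * j)) * Hnorm P s δ u)) := by
          rw [hrk]
          gcongr
          exact (hgb k hk _).trans (by gcongr)
      _ = C * (2 : ℝ) ^ (-((δ + 3 / 2 + k) * j)) * Hnorm P s δ u := by
          rw [show -((δ + 3 / 2 + k) * (j : ℝ)) = -((k : ℝ) * j) + -((δ + 3 / 2) * j) by ring,
            rpow_add (by norm_num)]
          ring

/-- Every point lies in a dyadic shell, half open on the inside. -/
lemma exists_dyadic_shell (x : E3) :
    ∃ j : ℕ, ‖x‖ ≤ (2 : ℝ) ^ (j : ℤ) ∧ (1 ≤ j → (2 : ℝ) ^ ((j : ℤ) - 1) < ‖x‖) := by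
  have hex : ∃ j : ℕ, ‖x‖ ≤ (2 : ℝ) ^ (j : ℤ) := by
    obtain ⟨n, hn⟩ := pow_unbounded_of_one_lt ‖x‖ (one_lt_two : (1 : ℝ) < 2)
    exact ⟨n, by simpa using hn.le⟩
  classical
  refine ⟨Nat.find hex, Nat.find_spec hex, fun hj ↦ ?_⟩
  have h := Nat.find_min hex (Nat.sub_lt hj one_pos)
  rw [not_le] at h
  rwa [Nat.cast_sub hj, Nat.cast_one] at h

lemma DyadicPartition.eq_one (P : DyadicPartition) {j : ℕ} {x : E3}
    (hx : ‖x‖ ≤ (2 : ℝ) ^ (j : ℤ)) (hx' : 1 ≤ j → (2 : ℝ) ^ ((j : ℤ) - 1) ≤ ‖x‖) :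
    P.ψ j x = 1 := by
  rcases Nat.eq_zero_or_pos j with rfl | hj
  · exact P.one_zero x (by simpa using hx)
  · exact P.one_succ j hj x (hx' hj) hx

/-- Continuous representatives of the dyadic pieces `ψ_j u` are the pieces `ψ_j v` of a single
representative `v` of `u`. -/
lemma exists_glue_dyadic_pieces (P : DyadicPartition) {u : E3 → ℝ} {h : ℕ → E3 → ℝ}
    (hc : ∀ j, Continuous (h j)) (hae : ∀ j, h j =ᵐ[volume] fun x ↦ P.ψ j x * u x) :
    ∃ v : E3 → ℝ, u =ᵐ[volume] v ∧ ∀ j x, h j x = P.ψ j x * v x := by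
  have hcomm : ∀ i j x, P.ψ j x * h i x = P.ψ i x * h j x := by
    intro i j
    refine congrFun ((Continuous.ae_eq_iff_eq volume ((P.smooth j).continuous.mul (hc i))
      ((P.smooth i).continuous.mul (hc j))).1 ?_)
    filter_upwards [hae i, hae j] with x hi hj
    rw [Pi.mul_apply, Pi.mul_apply, hi, hj]
    ring
  choose J hJ hJ' using exists_dyadic_shell
  have hone : ∀ x, P.ψ (J x) x = 1 := fun x ↦ P.eq_one (hJ x) fun hj ↦ (hJ' x hj).le
  refine ⟨fun x ↦ h (J x) x, ?_, fun j x ↦ ?_⟩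
  · filter_upwards [ae_all_iff.2 hae] with x hx
    rw [hx, hone, one_mul]
  · rw [← hcomm j (J x) x, hone, one_mul]

/-- On the `j`-th dyadic shell the weight `(1 + ‖x‖)^γ` is comparable to `2^(γ j)`. -/
lemma one_add_norm_rpow_le {j : ℕ} {x : E3} (γ : ℝ) (hx : ‖x‖ ≤ (2 : ℝ) ^ (j : ℤ))
    (hx' : 1 ≤ j → (2 : ℝ) ^ ((j : ℤ) - 1) ≤ ‖x‖) :
    (1 + ‖x‖) ^ γ ≤ 2 ^ |γ| * 2 ^ (γ * j) := by
  have hx2 : ‖x‖ ≤ (2 : ℝ) ^ j := by simpa using hx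
  have hp : (0 : ℝ) < 2 ^ j := by positivity
  have hone : (1 : ℝ) ≤ 2 ^ j := one_le_pow₀ one_le_two
  have hlow : (2 : ℝ) ^ j / 2 ≤ 1 + ‖x‖ := by
    rcases Nat.eq_zero_or_pos j with rfl | hj
    · have := norm_nonneg x
      norm_num
      linarith
    · have := hx' hj
      rw [zpow_sub_one₀ (by norm_num), zpow_natCast] at this
      linarith
  have hcast : (2 : ℝ) ^ (γ * j) = ((2 : ℝ) ^ j) ^ γ := by
    rw [mul_comm, rpow_mul (by norm_num), Real.rpow_natCast]
  rw [hcast]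
  rcases le_total 0 γ with hγ | hγ
  · rw [abs_of_nonneg hγ, ← mul_rpow (by norm_num) hp.le]
    exact rpow_le_rpow (by positivity) (by linarith) hγ
  · rw [abs_of_nonpos hγ, rpow_neg (by norm_num), ← inv_rpow (by norm_num),
      ← mul_rpow (by norm_num) hp.le]
    exact rpow_le_rpow_of_nonpos (by positivity) (by linarith) hγ

lemma exists_contDiff_weighted_bound (P : DyadicPartition) (s δ β : ℝ) (hβ : β ≤ δ + 3 / 2)
    (m : ℕ) (hs : (m : ℝ) + 3 / 2 < s) :
    ∃ C : ℝ, 0 < C ∧ ∀ u : E3 → ℝ, MemH P s δ u →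
      ∃ v : E3 → ℝ, ContDiff ℝ m v ∧ u =ᵐ[volume] v ∧
        ∀ k : ℕ, k ≤ m → ∀ x : E3,
          (1 + ‖x‖) ^ (β + (k : ℝ)) * ‖iteratedFDeriv ℝ k v x‖ ≤ C * Hnorm P s δ u := by
  obtain ⟨C, hC, hpieces⟩ := exists_contDiff_dyadic_pieces P δ hs
  refine ⟨2 ^ (|δ + 3 / 2| + m) * C, by positivity, fun u hu ↦ ?_⟩
  obtain ⟨h, hh⟩ := hpieces u hu
  obtain ⟨v, huv, hv⟩ :=
    exists_glue_dyadic_pieces P (fun j ↦ (hh j).1.continuous) fun j ↦ (hh j).2.1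
  have hsmooth : ContDiff ℝ m v := by
    rw [contDiff_iff_contDiffAt]
    intro x
    obtain ⟨j, hj, hj'⟩ := exists_dyadic_shell x
    have hone : P.ψ j x ≠ 0 := by
      rw [P.eq_one hj fun h ↦ (hj' h).le]
      exact one_ne_zero
    have hq : ContDiffAt ℝ m (fun y ↦ h j y / P.ψ j y) x :=
      (hh j).1.contDiffAt.div ((P.smooth j).of_le (by exact_mod_cast le_top)).contDiffAt hone
    refine hq.congr_of_eventuallyEq ?_
    filter_upwards [(P.smooth j).continuous.continuousAt.eventually_ne hone] with y hy
    rw [hv j y, mul_div_cancel_left₀ _ hy]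
  have hHn : 0 ≤ Hnorm P s δ u := Real.sqrt_nonneg _
  refine ⟨v, hsmooth, huv, fun k hk x ↦ ?_⟩
  have hopen : ∀ (j : ℕ) (y : E3), ‖y‖ < (2 : ℝ) ^ (j : ℤ) →
      (1 ≤ j → (2 : ℝ) ^ ((j : ℤ) - 1) < ‖y‖) →
      (1 + ‖y‖) ^ (β + (k : ℝ)) * ‖iteratedFDeriv ℝ k v y‖ ≤
        2 ^ (|δ + 3 / 2| + m) * C * Hnorm P s δ u := by
    intro j y hy hy'
    have heq : v =ᶠ[nhds y] h j := by
      have hlow : ∀ᶠ z in nhds y, 1 ≤ j → (2 : ℝ) ^ ((j : ℤ) - 1) < ‖z‖ := by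
        rcases Nat.eq_zero_or_pos j with rfl | hj
        · exact .of_forall fun z h0 ↦ absurd h0 (by norm_num)
        · exact (continuous_norm.continuousAt.eventually_const_lt (hy' hj)).mono fun z hz _ ↦ hz
      filter_upwards [continuous_norm.continuousAt.eventually_lt_const hy, hlow] with z hz hz'
      rw [hv j z, P.eq_one hz.le fun h ↦ (hz' h).le, one_mul]
    set γ : ℝ := δ + 3 / 2 + k with hγ
    have hγabs : |γ| ≤ |δ + 3 / 2| + m := by
      refine (abs_add_le _ _).trans ?_
      rw [Nat.abs_cast]
      gcongr
    rw [(heq.iteratedFDeriv ℝ k).eq_of_nhds]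
    calc (1 + ‖y‖) ^ (β + (k : ℝ)) * ‖iteratedFDeriv ℝ k (h j) y‖
        ≤ (2 ^ |γ| * 2 ^ (γ * j)) * (C * (2 : ℝ) ^ (-(γ * j)) * Hnorm P s δ u) := by
          gcongr
          · refine (rpow_le_rpow_of_exponent_le (by linarith [norm_nonneg y])
              (show β + k ≤ γ by linarith)).trans ?_
            exact one_add_norm_rpow_le γ hy.le fun h ↦ (hy' h).le
          · exact (hh j).2.2 k hk y
      _ = 2 ^ |γ| * C * Hnorm P s δ u := by
          rw [rpow_neg (by norm_num)]
          have : (2 : ℝ) ^ (γ * j) ≠ 0 := by positivity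
          field_simp
      _ ≤ 2 ^ (|δ + 3 / 2| + m) * C * Hnorm P s δ u := by
          gcongr
          norm_num
  obtain ⟨j, hj, hj'⟩ := exists_dyadic_shell x
  have hcont : Continuous fun y : E3 ↦
      (1 + ‖y‖) ^ (β + (k : ℝ)) * ‖iteratedFDeriv ℝ k v y‖ := by
    refine Continuous.mul ?_ (hsmooth.continuous_iteratedFDeriv (by exact_mod_cast hk)).norm
    exact (continuous_const.add continuous_norm).rpow_const fun y ↦
      Or.inl (by linarith [norm_nonneg y] : 0 < 1 + ‖y‖).ne'
  have hray : Filter.Tendsto (fun t : ℝ ↦ t • x) (nhdsWithin 1 (Iio 1)) (nhds x) := by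
    have : ContinuousAt (fun t : ℝ ↦ t • x) 1 := by fun_prop
    simpa using this.tendsto.mono_left nhdsWithin_le_nhds
  refine le_of_tendsto ((hcont.tendsto x).comp hray) ?_
  have hlow : ∀ᶠ t in nhdsWithin (1 : ℝ) (Iio 1),
      1 ≤ j → (2 : ℝ) ^ ((j : ℤ) - 1) < ‖t • x‖ := by
    rcases Nat.eq_zero_or_pos j with rfl | hj0
    · exact .of_forall fun t h0 ↦ absurd h0 (by norm_num)
    · exact (hray.norm.eventually_const_lt (hj' hj0)).mono fun t ht _ ↦ ht
  have hpos : ∀ᶠ t in nhdsWithin (1 : ℝ) (Iio 1), 0 < t :=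
    nhdsWithin_le_nhds (lt_mem_nhds one_pos)
  filter_upwards [hlow, hpos, self_mem_nhdsWithin] with t ht ht0 ht1
  refine hopen j (t • x) ?_ ht
  rw [norm_smul, Real.norm_of_nonneg ht0.le]
  calc t * ‖x‖ ≤ t * (2 : ℝ) ^ (j : ℤ) := by gcongr
    _ < 1 * (2 : ℝ) ^ (j : ℤ) := by
        gcongr
        exact ht1
    _ = (2 : ℝ) ^ (j : ℤ) := one_mul _

/-- Weighted Sobolev embedding.
(i) If `s > 3/2` and `β ≤ δ + 3/2`, then `‖u‖_{L^∞_β} ≤ C ‖u‖_{H_{s,δ}}` (for a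
continuous representative of `u`).
(ii) If `m + 3/2 < s` and `β ≤ δ + 3/2`, then `u` has continuous partial derivatives up
to order `m` and `‖u‖_{C^m_β} ≤ C ‖u‖_{H_{s,δ}}`. -/
theorem weighted_sobolev_embedding (P : DyadicPartition) (s δ β : ℝ)
    (hβ : β ≤ δ + 3/2) :
    (3/2 < s →
      ∃ C : ℝ, 0 < C ∧ ∀ u : E3 → ℝ, MemH P s δ u →
        ∃ v : E3 → ℝ, Continuous v ∧ u =ᵐ[volume] v ∧
          ∀ x : E3, (1 + ‖x‖) ^ β * |v x| ≤ C * Hnorm P s δ u) ∧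
    (∀ m : ℕ, (m : ℝ) + 3/2 < s →
      ∃ C : ℝ, 0 < C ∧ ∀ u : E3 → ℝ, MemH P s δ u →
        ∃ v : E3 → ℝ, ContDiff ℝ (m : ℕ∞) v ∧ u =ᵐ[volume] v ∧
          ∀ k : ℕ, k ≤ m → ∀ x : E3,
            (1 + ‖x‖) ^ (β + (k : ℝ)) * ‖iteratedFDeriv ℝ k v x‖ ≤ C * Hnorm P s δ u) := by
  refine ⟨fun hs ↦ ?_, fun m hm ↦ exists_contDiff_weighted_bound P s δ β hβ m hm⟩
  obtain ⟨C, hC, H⟩ :=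
    exists_contDiff_weighted_bound P s δ β hβ 0 (by rw [Nat.cast_zero, zero_add]; exact hs)
  refine ⟨C, hC, fun u hu ↦ ?_⟩
  obtain ⟨v, hv, huv, hb⟩ := H u hu
  exact ⟨v, hv.continuous, huv, fun x ↦ by simpa using hb 0 le_rfl x⟩
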